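/- Let q be a prime power, Q = q², n a positive integer with gcd(n, q) = 1, m = ord_n(Q), and β a primitive n-th root of unity in GF(Q^m). Let C be a cyclic code of length n over GF(Q) with generator polynomial g(x), and let S = {0 ≤ i ≤ n−1 : g(β^i) = 0} be its defining set. Then the following are equivalent: (a) C is a Hermitian LCD code; (b) S = −qS (mod n), where −qS = {−qs mod n : s ∈ S}; (c) for every root γ of g(x) in GF(Q^m), γ^{−q} is also a root of g(x). -/

import Mathlib

open Polynomial

noncomputable section

/-- The cyclic shift of a vector: `(c₀,…,c_{n−1}) ↦ (c_{n−1},c₀,…,c_{n−2})`. -/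
def cyclicShift {F : Type*} {n : ℕ} (c : Fin n → F) : Fin n → F :=
  fun i => c ⟨(i.val + (n - 1)) % n, Nat.mod_lt _ i.pos⟩

/-- A linear code (submodule of `F^n`) is cyclic if it is stable under the cyclic shift. -/
def IsCyclicCode {F : Type*} [Field F] {n : ℕ} (C : Submodule F (Fin n → F)) : Prop :=
  ∀ c ∈ C, cyclicShift c ∈ C

/-- The Hermitian dual `C^⊥H = {b : ∑ i, b i * (c i)^q = 0 for all c ∈ C}`. -/
def hermDualSet {F : Type*} [Field F] (q : ℕ) {n : ℕ} (C : Set (Fin n → F)) :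
    Set (Fin n → F) :=
  {b | ∀ c ∈ C, ∑ i, b i * (c i) ^ q = 0}

/-- A code is Hermitian LCD if `C ∩ C^⊥H = {0}`. -/
def IsHermitianLCD {F : Type*} [Field F] (q : ℕ) {n : ℕ} (C : Set (Fin n → F)) : Prop :=
  C ∩ hermDualSet q C = {0}

/-- The polynomial `c₀ + c₁ x + ⋯ + c_{n−1} x^{n−1}` associated with a vector. -/
def polyOfVec {F : Type*} [Field F] {n : ℕ} (c : Fin n → F) : Polynomial F :=
  ∑ i : Fin n, Polynomial.C (c i) * Polynomial.X ^ (i : ℕ)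

/-- The cyclic code of length `n` with generator polynomial `g` (for `g ∣ xⁿ − 1`):
vectors whose associated polynomial (of degree `< n`) is divisible by `g`. -/
def cyclicCodeOf {F : Type*} [Field F] (n : ℕ) (g : Polynomial F) :
    Submodule F (Fin n → F) where
  carrier := {c | g ∣ polyOfVec c}
  add_mem' := by
    intro a b ha hb
    have h : polyOfVec (a + b) = polyOfVec a + polyOfVec b := by
      simp [polyOfVec, add_mul, Finset.sum_add_distrib]
    simpa [Set.mem_setOf_eq, h] using dvd_add ha hb
  zero_mem' := by simp [polyOfVec]
  smul_mem' := by
    intro r c hc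
    have h : polyOfVec (r • c) = Polynomial.C r * polyOfVec c := by
      simp [polyOfVec, Finset.mul_sum, mul_assoc]
    simpa [Set.mem_setOf_eq, h] using hc.mul_left (Polynomial.C r)

/-- `f̄`: the polynomial obtained by raising every coefficient of `f` to the `q`-th power. -/
def conjPoly {F : Type*} [Field F] (q : ℕ) (f : Polynomial F) : Polynomial F :=
  f.sum fun i a => Polynomial.C (a ^ q) * Polynomial.X ^ i

/-- The reciprocal polynomial `f*(x) = f₀⁻¹ xᵗ f(1/x)`. -/
def recipPoly {F : Type*} [Field F] (f : Polynomial F) : Polynomial F :=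
  Polynomial.C (f.coeff 0)⁻¹ * f.reverse

/-- The `Q`-cyclotomic coset of `s` modulo `n`, as a subset of `{0,…,n−1} ⊆ ℕ`
(`s` is taken as an integer so that negative indices are allowed). -/
def cycCoset (Q n : ℕ) (s : ℤ) : Set ℕ :=
  {x | x < n ∧ ∃ j : ℕ, (x : ℤ) ≡ s * (Q : ℤ) ^ j [ZMOD n]}

end

/-- The coefficient vector of the residue of `P` modulo `X ^ n - 1`. -/
noncomputable def vecOfPoly {F : Type*} [Field F] (n : ℕ) (P : Polynomial F) : Fin n → F :=
  fun i => (P %ₘ (X ^ n - 1)).coeff i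

section CyclicCodes

variable {F E : Type*} [Field F] [Field E] [Algebra F E] {n : ℕ}

lemma aeval_polyOfVec (c : Fin n → F) (y : E) :
    aeval y (polyOfVec c) = ∑ i : Fin n, algebraMap F E (c i) * y ^ (i : ℕ) := by
  simp [polyOfVec]

lemma monic_X_pow_sub_one (hn : 0 < n) : (X ^ n - 1 : Polynomial F).Monic := by
  simpa using monic_X_pow_sub_C (1 : F) hn.ne'

lemma polyOfVec_vecOfPoly (hn : 0 < n) (P : Polynomial F) :
    polyOfVec (vecOfPoly n P) = P %ₘ (X ^ n - 1) := by
  have hdeg : (P %ₘ (X ^ n - 1)).natDegree < n := by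
    have h := natDegree_modByMonic_lt P (monic_X_pow_sub_one (F := F) hn) (by
      intro h
      have := congrArg natDegree h
      rw [← C_1, natDegree_X_pow_sub_C, natDegree_C] at this
      omega)
    rwa [← C_1, natDegree_X_pow_sub_C] at h
  rw [(P %ₘ (X ^ n - 1)).as_sum_range_C_mul_X_pow' hdeg, Finset.sum_range]
  rfl

lemma dvd_polyOfVec_vecOfPoly (hn : 0 < n) {g P : Polynomial F} (hg : g ∣ X ^ n - 1)
    (hP : g ∣ P) : g ∣ polyOfVec (vecOfPoly n P) := by
  rw [polyOfVec_vecOfPoly hn, modByMonic_eq_sub_mul_div]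
  exact dvd_sub hP (hg.mul_right _)

lemma aeval_polyOfVec_vecOfPoly (hn : 0 < n) (P : Polynomial F) {y : E} (hy : y ^ n = 1) :
    aeval y (polyOfVec (vecOfPoly n P)) = aeval y P := by
  rw [polyOfVec_vecOfPoly hn, modByMonic_eq_sub_mul_div]
  simp [hy]

lemma sum_pow_mul_inv_pow {β : E} (hβ : IsPrimitiveRoot β n) (i j : Fin n) :
    ∑ k : Fin n, (β ^ (k : ℕ)) ^ (i : ℕ) * ((β ^ (k : ℕ))⁻¹) ^ (j : ℕ) =
      if i = j then (n : E) else 0 := by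
  have hβ0 : β ≠ 0 := hβ.ne_zero i.pos.ne'
  have hterm (k : Fin n) : (β ^ (k : ℕ)) ^ (i : ℕ) * ((β ^ (k : ℕ))⁻¹) ^ (j : ℕ) =
      (β ^ (i : ℕ) * (β ^ (j : ℕ))⁻¹) ^ (k : ℕ) := by
    rw [mul_pow, inv_pow, inv_pow]
    simp only [← pow_mul, mul_comm]
  simp_rw [hterm]
  split_ifs with h
  · subst h
    simp [hβ0]
  · have hne : β ^ (i : ℕ) * (β ^ (j : ℕ))⁻¹ ≠ 1 := by
      intro h1
      rw [mul_inv_eq_one₀ (pow_ne_zero _ hβ0)] at h1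
      exact h (Fin.ext (hβ.pow_inj i.isLt j.isLt h1))
    rw [← Finset.sum_range (fun k => (β ^ (i : ℕ) * (β ^ (j : ℕ))⁻¹) ^ k), geom_sum_eq hne,
      mul_pow, inv_pow, ← pow_mul, ← pow_mul, mul_comm (i : ℕ), mul_comm (j : ℕ), pow_mul,
      pow_mul, hβ.pow_eq_one]
    simp

/-- Parseval's identity for the discrete Fourier transform, twisted by `σ`. -/
lemma sum_aeval_mul_aeval_inv {β : E} (hβ : IsPrimitiveRoot β n) (σ : F →+* F)
    (b c : Fin n → F) :
    ∑ k : Fin n, aeval (β ^ (k : ℕ)) (polyOfVec b) *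
        aeval (β ^ (k : ℕ))⁻¹ ((polyOfVec c).map σ) =
      n * algebraMap F E (∑ i, b i * σ (c i)) := by
  have hc : (polyOfVec c).map σ = polyOfVec (fun i => σ (c i)) := by
    simp [polyOfVec, Polynomial.map_sum]
  simp_rw [hc, aeval_polyOfVec, Finset.sum_mul_sum]
  rw [Finset.sum_comm]
  have hi (i : Fin n) : ∑ k : Fin n, ∑ j : Fin n,
      algebraMap F E (b i) * (β ^ (k : ℕ)) ^ (i : ℕ) *
        (algebraMap F E (σ (c j)) * ((β ^ (k : ℕ))⁻¹) ^ (j : ℕ)) =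
      n * (algebraMap F E (b i) * algebraMap F E (σ (c i))) := by
    rw [Finset.sum_comm]
    calc _ = ∑ j : Fin n, algebraMap F E (b i) * algebraMap F E (σ (c j)) *
          ∑ k : Fin n, (β ^ (k : ℕ)) ^ (i : ℕ) * ((β ^ (k : ℕ))⁻¹) ^ (j : ℕ) := by
          refine Finset.sum_congr rfl fun j _ => ?_
          rw [Finset.mul_sum]
          exact Finset.sum_congr rfl fun k _ => by ring
      _ = _ := by
          simp_rw [sum_pow_mul_inv_pow hβ]
          simp [mul_comm]
  simp_rw [hi]
  simp [Finset.mul_sum]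

lemma polyOfVec_eq_zero_of_aeval {β : E} (hβ : IsPrimitiveRoot β n) (hn : (n : E) ≠ 0)
    {b : Fin n → F} (h : ∀ y : E, y ^ n = 1 → aeval y (polyOfVec b) = 0) : b = 0 := by
  have hβ' (k : ℕ) : (β ^ k) ^ n = 1 := by
    rw [← pow_mul, mul_comm, pow_mul, hβ.pow_eq_one, one_pow]
  funext i
  have hsum := sum_aeval_mul_aeval_inv hβ (RingHom.id F) b (Pi.single i 1)
  simp only [h _ (hβ' _), zero_mul, Finset.sum_const_zero] at hsum
  simpa [Pi.single_apply, hn] using hsum.symm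

/-- A vector orthogonal to the code generated by `g`, for the form twisted by `σ`,
satisfies a pointwise annihilation condition on the `n`-th roots of unity. -/
lemma aeval_mul_aeval_inv_eq_zero {β : E} (hβ : IsPrimitiveRoot β n) (hn : 0 < n)
    (σ : F →+* F) {g : Polynomial F} (hg : g ∣ X ^ n - 1) {b : Fin n → F}
    (hb : ∀ c ∈ cyclicCodeOf n g, ∑ i, b i * σ (c i) = 0) (k : Fin n) :
    aeval (β ^ (k : ℕ)) (polyOfVec b) * aeval (β ^ (k : ℕ))⁻¹ (g.map σ) = 0 := by
  have hβ' (k : ℕ) : ((β ^ k)⁻¹) ^ n = 1 := by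
    rw [inv_pow, ← pow_mul, mul_comm, pow_mul, hβ.pow_eq_one, one_pow, inv_one]
  have hinj : Function.Injective fun k : Fin n => (β ^ (k : ℕ))⁻¹ := fun i j hij =>
    Fin.ext (hβ.pow_inj i.isLt j.isLt (inv_injective hij))
  refine congrFun (Matrix.eq_zero_of_forall_pow_sum_mul_pow_eq_zero hinj
    (v := fun k : Fin n =>
      aeval (β ^ (k : ℕ)) (polyOfVec b) * aeval (β ^ (k : ℕ))⁻¹ (g.map σ)) fun l => ?_) k
  have hmem : vecOfPoly n (g * X ^ (l : ℕ)) ∈ cyclicCodeOf n g :=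
    dvd_polyOfVec_vecOfPoly hn hg (dvd_mul_right _ _)
  have hsum := sum_aeval_mul_aeval_inv hβ σ b (vecOfPoly n (g * X ^ (l : ℕ)))
  rw [hb _ hmem, map_zero, mul_zero] at hsum
  rw [← hsum]
  refine Finset.sum_congr rfl fun k _ => ?_
  have hmap : aeval (β ^ (k : ℕ))⁻¹ ((polyOfVec (vecOfPoly n (g * X ^ (l : ℕ)))).map σ) =
      aeval (β ^ (k : ℕ))⁻¹ ((g * X ^ (l : ℕ)).map σ) := by
    rw [polyOfVec_vecOfPoly hn, modByMonic_eq_sub_mul_div]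
    simp [hβ']
  rw [hmap]
  simp [mul_assoc]

lemma aeval_pow_map {q : ℕ} {σ : F →+* F} {τ : E →+* E} (hσ : ∀ x, σ x = x ^ q)
    (hτ : ∀ x, τ x = x ^ q) (P : Polynomial F) (y : E) :
    aeval (y ^ q) (P.map σ) = (aeval y P) ^ q := by
  rw [← hτ, ← hτ, aeval_def, aeval_def, hom_eval₂, eval₂_map]
  congr 1
  ext x
  simp [hσ, hτ]

/-- The Hermitian LCD property in terms of the roots of the generator polynomial. -/
lemma isHermitianLCD_cyclicCodeOf_iff {q : ℕ} (hn : 0 < n) (hco : Nat.Coprime n q)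
    {σ : F →+* F} {τ : E →+* E} (hσ : ∀ x, σ x = x ^ q) (hτ : ∀ x, τ x = x ^ q)
    (hnF : (n : F) ≠ 0) {β : E} (hβ : IsPrimitiveRoot β n)
    {g : Polynomial F} (hg : g ∣ X ^ n - 1) :
    IsHermitianLCD q (cyclicCodeOf n g : Set (Fin n → F)) ↔
      ∀ γ : E, aeval γ g = 0 → aeval (γ ^ q)⁻¹ g = 0 := by
  have : NeZero n := ⟨hn.ne'⟩
  have hnE : (n : E) ≠ 0 := by
    simpa using (map_ne_zero (algebraMap F E)).2 hnF
  have hβ' (k : ℕ) : (β ^ k) ^ n = 1 := by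
    rw [← pow_mul, mul_comm, pow_mul, hβ.pow_eq_one, one_pow]
  obtain ⟨h, hgh⟩ := hg
  constructor
  · intro hLCD γ hγ
    by_contra hγq
    have hγn : γ ^ n = 1 := by
      have := congrArg (aeval γ) hgh
      simpa [hγ, sub_eq_zero] using this
    have hγ0 : γ ≠ 0 := by
      rintro rfl
      simp [hn.ne'] at hγn
    have hyn : ((γ ^ q)⁻¹) ^ n = 1 := by
      rw [inv_pow, ← pow_mul, mul_comm, pow_mul, hγn, one_pow, inv_one]
    have hinv (y : E) (hy : y ^ n = 1) : y ^ (n - 1) = y⁻¹ :=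
      eq_inv_of_mul_eq_one_left (by rw [← pow_succ, Nat.sub_add_cancel hn, hy])
    have hhγ : aeval γ h ≠ 0 := by
      intro h0
      have hsep : (X ^ n - 1 : Polynomial F).Separable := by
        simpa using separable_X_pow_sub_C (1 : F) hnF one_ne_zero
      rw [hgh] at hsep
      obtain ⟨u, v, huv⟩ := hsep.isCoprime
      have := congrArg (aeval γ) huv
      simp [h0, hγ] at this
    set P : Polynomial F := g * (h.map σ).comp (X ^ (n - 1)) with hP
    have hPy (y : E) (hy : y ^ n = 1) : aeval y (polyOfVec (vecOfPoly n P)) =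
        aeval y g * aeval y⁻¹ (h.map σ) := by
      rw [aeval_polyOfVec_vecOfPoly hn _ hy, hP, map_mul, aeval_comp]
      simp [hinv y hy]
    have hmem : vecOfPoly n P ∈
        (cyclicCodeOf n g : Set (Fin n → F)) ∩ hermDualSet q (cyclicCodeOf n g) := by
      refine ⟨dvd_polyOfVec_vecOfPoly hn ⟨h, hgh⟩ (dvd_mul_right _ _), ?_⟩
      rintro c ⟨u, hu⟩
      have hsum := sum_aeval_mul_aeval_inv hβ σ (vecOfPoly n P) c
      rw [Finset.sum_eq_zero] at hsum
      · have hzero := (mul_eq_zero.1 hsum.symm).resolve_left hnE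
        simpa only [hσ] using (map_eq_zero (algebraMap F E)).1 hzero
      · intro k _
        have hmap := congrArg (fun p => aeval (β ^ (k : ℕ))⁻¹ (p.map σ)) hgh
        simp only [Polynomial.map_sub, Polynomial.map_pow, map_X, Polynomial.map_one, map_sub,
          map_pow, aeval_X, map_one, inv_pow, hβ', inv_one, sub_self, Polynomial.map_mul,
          map_mul] at hmap
        rw [hPy _ (hβ' _), hu, Polynomial.map_mul, map_mul]
        linear_combination (-aeval (β ^ (k : ℕ)) g * aeval (β ^ (k : ℕ))⁻¹ (u.map σ)) * hmap
    rw [hLCD, Set.mem_singleton_iff] at hmem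
    have hzero := hPy _ hyn
    rw [hmem, inv_inv, aeval_pow_map hσ hτ] at hzero
    exact mul_ne_zero hγq (pow_ne_zero q hhγ) (by simpa [polyOfVec] using hzero.symm)
  · intro hroots
    refine Set.Subset.antisymm ?_ ?_
    · rintro b ⟨hb, hbd⟩
      refine polyOfVec_eq_zero_of_aeval hβ hnE fun y hy => ?_
      obtain ⟨k, hk, rfl⟩ := hβ.eq_pow_of_pow_eq_one hy
      have hmul := aeval_mul_aeval_inv_eq_zero hβ hn σ ⟨h, hgh⟩
        (b := b) (fun c hc => by simpa only [hσ] using hbd c hc) ⟨k, hk⟩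
      obtain ⟨m, hm⟩ := exists_pow_eq_self_of_coprime (x := (β ^ k)⁻¹) (n := q)
        ((hco.coprime_dvd_left (orderOf_dvd_of_pow_eq_one (by rw [inv_pow, hy, inv_one]))).symm)
      rw [← pow_mul, mul_comm, pow_mul] at hm
      simp only at hmul
      rcases mul_eq_zero.1 hmul with h0 | h0
      · exact h0
      · rw [← hm, aeval_pow_map hσ hτ] at h0
        have h1 := hroots _ (eq_zero_of_pow_eq_zero h0)
        rw [hm, inv_inv] at h1
        obtain ⟨u, hu⟩ := hb
        rw [hu, map_mul, h1, zero_mul]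
    · rintro _ rfl
      refine ⟨Submodule.zero_mem _, ?_⟩
      intro c _
      simp

lemma image_neg_mul_eq_iff {q : ℕ} (hn : 0 < n) (hco : Nat.Coprime n q) {β : E}
    (hβ : IsPrimitiveRoot β n) {g : Polynomial F} (hg : g ∣ X ^ n - 1) :
    (fun s : ZMod n => -(q : ZMod n) * s) '' {i : ZMod n | aeval (β ^ i.val) g = 0} =
        {i : ZMod n | aeval (β ^ i.val) g = 0} ↔
      ∀ γ : E, aeval γ g = 0 → aeval (γ ^ q)⁻¹ g = 0 := by
  have : NeZero n := ⟨hn.ne'⟩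
  have hpow (i : ZMod n) : β ^ (-(q : ZMod n) * i).val = ((β ^ i.val) ^ q)⁻¹ := by
    refine eq_inv_of_mul_eq_one_left ?_
    rw [← pow_mul, ← pow_add, hβ.pow_eq_one_iff_dvd, ← ZMod.natCast_eq_zero_iff]
    simp [mul_comm]
  have hinj : Function.Injective fun s : ZMod n => -(q : ZMod n) * s :=
    ((ZMod.unitOfCoprime q hco.symm).isUnit.neg).mul_right_injective
  constructor
  · intro hS γ hγ
    have hγn : γ ^ n = 1 := by
      obtain ⟨h, hgh⟩ := hg
      have := congrArg (aeval γ) hgh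
      simpa [hγ, sub_eq_zero] using this
    obtain ⟨k, hk, rfl⟩ := hβ.eq_pow_of_pow_eq_one hγn
    have hval : (k : ZMod n).val = k := ZMod.val_cast_of_lt hk
    have hmem := hS.subset ⟨(k : ZMod n), by simpa [hval] using hγ, rfl⟩
    simpa only [Set.mem_ofPred_eq, hpow, hval] using hmem
  · intro hroots
    refine Set.eq_of_subset_of_ncard_le ?_ (Set.ncard_image_of_injective _ hinj).ge
      (Set.toFinite _)
    rintro _ ⟨i, hi, rfl⟩
    simpa only [Set.mem_ofPred_eq, hpow] using hroots _ hi

end CyclicCodes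

/-- For a cyclic code `C = ⟨g⟩` of length `n` over `GF(q²)` with defining set
`S = {i : g(βⁱ) = 0}` (`β` a primitive `n`-th root of unity), the following are equivalent:
(a) `C` is Hermitian LCD; (b) `S = −qS (mod n)`; (c) for every root `γ` of `g`,
`γ^{−q}` is also a root of `g`. -/
theorem stmt2 {q n : ℕ} (hq : IsPrimePow q) (hn : 0 < n) (hco : Nat.Coprime n q)
    {F : Type*} [Field F] [Fintype F] (hF : Fintype.card F = q ^ 2)
    {E : Type*} [Field E] [Algebra F E] (β : E) (hβ : IsPrimitiveRoot β n)
    (g : Polynomial F) (hg : g.Monic) (hgdvd : g ∣ X ^ n - 1)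
    (S : Set (ZMod n)) (hS : S = {i : ZMod n | Polynomial.aeval (β ^ i.val) g = 0}) :
    (IsHermitianLCD q ((cyclicCodeOf n g : Submodule F (Fin n → F)) : Set (Fin n → F)) ↔
        (fun s : ZMod n => -(q : ZMod n) * s) '' S = S) ∧
    (IsHermitianLCD q ((cyclicCodeOf n g : Submodule F (Fin n → F)) : Set (Fin n → F)) ↔
        ∀ γ : E, Polynomial.aeval γ g = 0 → Polynomial.aeval (γ ^ (-(q : ℤ))) g = 0) := by
  obtain ⟨p, a, hp, ha, rfl⟩ := hq
  have hp' : p.Prime := hp.nat_prime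
  have : Fact p.Prime := ⟨hp'⟩
  have hcharF : CharP F p := by
    refine charP_of_card_eq_prime_pow (f := a * 2) ?_
    rw [← Nat.card_eq_fintype_card] at hF ⊢
    rw [hF, pow_mul]
  have hcharE : CharP E p := charP_of_injective_algebraMap (algebraMap F E).injective p
  have hnF : (n : F) ≠ 0 := by
    rw [Ne, CharP.cast_eq_zero_iff F p]
    intro hpn
    exact hp'.one_lt.ne' (Nat.eq_one_of_dvd_coprimes hco hpn (dvd_pow_self p ha.ne'))
  have hLCD := isHermitianLCD_cyclicCodeOf_iff hn hco (σ := iterateFrobenius F p a)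
    (τ := iterateFrobenius E p a) (fun x => iterateFrobenius_def p a x)
    (fun x => iterateFrobenius_def p a x) hnF hβ hgdvd
  subst hS
  refine ⟨hLCD.trans (image_neg_mul_eq_iff hn hco hβ hgdvd).symm, ?_⟩
  simpa only [zpow_neg, zpow_natCast] using hLCD
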